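/- For every n ≥ 1, the permutation ϕ_{4n+2} := e_{2n+1} |⋄ β_{2n+1} ∈ S_{4n+2} is a simple permutation of order 4n+2, i.e., ϕ_{4n+2} ∈ Sim(4n+2); in particular ϕ_{4n+2} is a (4n+2)-cycle. -/

import Mathlib

/-- Reversing of a permutation of `Fin m`: the 0-based version of
`α̃(k) = α(m+1−k)` on `{1,…,m}`. -/
def reversing {m : ℕ} (α : Equiv.Perm (Fin m)) : Equiv.Perm (Fin m) :=
  Fin.revPerm.trans α

/-- Right pasting `α⋄|β`: `(α⋄|β)(i) = α(i)` on the first block and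
`(α⋄|β)(m+j) = β(j)+m` on the second block. -/
def rpaste {m n : ℕ} (α : Equiv.Perm (Fin m)) (β : Equiv.Perm (Fin n)) :
    Equiv.Perm (Fin (m + n)) :=
  finSumFinEquiv.permCongr (Equiv.sumCongr α β)

/-- Left pasting `α|⋄β`: `(α|⋄β)(i) = α(i)+n` on the first block and
`(α|⋄β)(m+j) = β(j)` on the second block. -/
def lpaste {m n : ℕ} (α : Equiv.Perm (Fin m)) (β : Equiv.Perm (Fin n)) :
    Equiv.Perm (Fin (m + n)) :=
  finSumFinEquiv.symm.trans
    (((Equiv.sumCongr α β).trans (Equiv.sumComm (Fin m) (Fin n))).trans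
      (finSumFinEquiv.trans (finCongr (Nat.add_comm n m))))

/-- 0-based version of the Stefan permutation `α_{2n+1}`:
`α(i) = 2n+2−i` for `1 ≤ i ≤ n`, `α(i) = 2n+1−i` for `n+1 ≤ i ≤ 2n`,
`α(2n+1) = n+1` (1-based). -/
def stefanAlphaFun (n : ℕ) (i : ℕ) : ℕ :=
  if i < n then 2 * n - i else if i < 2 * n then 2 * n - 1 - i else n

/-- 0-based version of the Stefan permutation `β_{2n+1}`:
`β(1) = n+1`, `β(i) = 2n+3−i` for `2 ≤ i ≤ n+1`, `β(i) = 2n+2−i` for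
`n+2 ≤ i ≤ 2n+1` (1-based). -/
def stefanBetaFun (n : ℕ) (i : ℕ) : ℕ :=
  if i = 0 then n else if i ≤ n then 2 * n + 1 - i else 2 * n - i

/-- `θ ∈ Sim(4n+2)`: `θ` is a `(4n+2)`-cycle, `θ` interchanges the two blocks
`{1,…,2n+1}` and `{2n+2,…,4n+2}`, `θ²` preserves each block, and the
permutation induced by `θ²` on each block is `α_{2n+1}` or `β_{2n+1}`
(everything written 0-based). -/
def IsSim (n : ℕ) (θ : Equiv.Perm (Fin (4 * n + 2))) : Prop :=
  θ.IsCycle ∧ θ.support = Finset.univ ∧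
  (∀ i : Fin (4 * n + 2), ((i : ℕ) < 2 * n + 1 ↔ 2 * n + 1 ≤ (θ i : ℕ))) ∧
  (∀ i : Fin (4 * n + 2), ((i : ℕ) < 2 * n + 1 ↔ ((θ ^ 2) i : ℕ) < 2 * n + 1)) ∧
  ((∀ i : Fin (4 * n + 2), (i : ℕ) < 2 * n + 1 → ((θ ^ 2) i : ℕ) = stefanAlphaFun n i) ∨
   (∀ i : Fin (4 * n + 2), (i : ℕ) < 2 * n + 1 → ((θ ^ 2) i : ℕ) = stefanBetaFun n i)) ∧
  ((∀ i : Fin (4 * n + 2), 2 * n + 1 ≤ (i : ℕ) →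
      ((θ ^ 2) i : ℕ) = stefanAlphaFun n ((i : ℕ) - (2 * n + 1)) + (2 * n + 1)) ∨
   (∀ i : Fin (4 * n + 2), 2 * n + 1 ≤ (i : ℕ) →
      ((θ ^ 2) i : ℕ) = stefanBetaFun n ((i : ℕ) - (2 * n + 1)) + (2 * n + 1)))

theorem stefanBetaFun_lt (n j : ℕ) (hj : j < 2 * n + 1) : stefanBetaFun n j < 2 * n + 1 := by
  unfold stefanBetaFun
  split_ifs <;> omega

theorem lpaste_castAdd {m n : ℕ} (α : Equiv.Perm (Fin m)) (β : Equiv.Perm (Fin n)) (i : Fin m) :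
    (lpaste α β (Fin.castAdd n i) : ℕ) = α i + n := by
  simp [lpaste, Nat.add_comm]

theorem lpaste_natAdd {m n : ℕ} (α : Equiv.Perm (Fin m)) (β : Equiv.Perm (Fin n)) (j : Fin n) :
    (lpaste α β (Fin.natAdd m j) : ℕ) = β j := by
  simp [lpaste]

/-- A permutation that shifts the first block of length `2n+1` onto the second one, and maps the
second block back by the Stefan permutation `β_{2n+1}`, is transitive. -/
theorem sameCycle_of_shift_of_stefanBeta {n : ℕ} {θ : Equiv.Perm (Fin (4 * n + 2))}
    (hlow : ∀ i : Fin (4 * n + 2), (i : ℕ) < 2 * n + 1 → (θ i : ℕ) = i + (2 * n + 1))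
    (hhigh : ∀ i : Fin (4 * n + 2), 2 * n + 1 ≤ (i : ℕ) →
      (θ i : ℕ) = stefanBetaFun n (i - (2 * n + 1)))
    (x y : Fin (4 * n + 2)) : θ.SameCycle x y := by
  have step (a b : ℕ) (ha : a < 2 * n + 1) (hb : b < 4 * n + 2) (hab : stefanBetaFun n a = b) :
      θ.SameCycle ⟨a, by omega⟩ ⟨b, hb⟩ := by
    refine ⟨2, Fin.ext ?_⟩
    have h1 := hlow ⟨a, by omega⟩ ha
    have h2 := hhigh (θ ⟨a, by omega⟩) (by omega)
    rw [h1] at h2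
    simpa [zpow_ofNat, pow_two, hab] using h2
  -- The orbit of `n` under `β` is `n, n + 1, n - 1, n + 2, n - 2, …, 1, 2n, 0`.
  have desc (k : ℕ) (hk : k ≤ n) :
      θ.SameCycle ⟨n, by omega⟩ ⟨n - k, by omega⟩ := by
    induction k with
    | zero => exact .refl _ _
    | succ k ih =>
      refine (ih (by omega)).trans ((step (n - k) (n + 1 + k) (by omega) (by omega) ?_).trans
        (step (n + 1 + k) (n - (k + 1)) (by omega) (by omega) ?_)) <;>
      · unfold stefanBetaFun
        split_ifs <;> omega
  have low (a : ℕ) (ha : a < 2 * n + 1) : θ.SameCycle ⟨n, by omega⟩ ⟨a, by omega⟩ := by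
    rcases le_or_gt a n with h | h
    · convert desc (n - a) (by omega) using 2
      omega
    · refine (desc (a - (n + 1)) (by omega)).trans (step _ a (by omega) (by omega) ?_)
      unfold stefanBetaFun
      split_ifs <;> omega
  have all (z : Fin (4 * n + 2)) : θ.SameCycle ⟨n, by omega⟩ z := by
    rcases lt_or_ge (z : ℕ) (2 * n + 1) with h | h
    · exact low z h
    · rw [← Equiv.Perm.sameCycle_apply_right]
      have := stefanBetaFun_lt n (z - (2 * n + 1)) (by omega)
      exact low (θ z) (by rw [hhigh z h]; exact this)
  exact (all x).symm.trans (all y)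

theorem isSim_of_shift_of_stefanBeta {n : ℕ} {θ : Equiv.Perm (Fin (4 * n + 2))}
    (hlow : ∀ i : Fin (4 * n + 2), (i : ℕ) < 2 * n + 1 → (θ i : ℕ) = i + (2 * n + 1))
    (hhigh : ∀ i : Fin (4 * n + 2), 2 * n + 1 ≤ (i : ℕ) →
      (θ i : ℕ) = stefanBetaFun n (i - (2 * n + 1))) :
    IsSim n θ := by
  have hlt (i : Fin (4 * n + 2)) (hi : 2 * n + 1 ≤ (i : ℕ)) : (θ i : ℕ) < 2 * n + 1 := by
    rw [hhigh i hi]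
    exact stefanBetaFun_lt n _ (by omega)
  have hne (i : Fin (4 * n + 2)) : θ i ≠ i := by
    intro h
    have h' := congrArg Fin.val h
    have := hlow i
    have := hlt i
    omega
  have hsq_low (i : Fin (4 * n + 2)) (hi : (i : ℕ) < 2 * n + 1) :
      ((θ ^ 2) i : ℕ) = stefanBetaFun n i := by
    have h1 := hlow i hi
    rw [pow_two, Equiv.Perm.mul_apply, hhigh _ (by omega), h1, Nat.add_sub_cancel]
  have hsq_high (i : Fin (4 * n + 2)) (hi : 2 * n + 1 ≤ (i : ℕ)) :
      ((θ ^ 2) i : ℕ) = stefanBetaFun n (i - (2 * n + 1)) + (2 * n + 1) := by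
    rw [pow_two, Equiv.Perm.mul_apply, hlow _ (hlt i hi), hhigh i hi]
  refine ⟨⟨⟨0, by omega⟩, hne _, fun y _ => sameCycle_of_shift_of_stefanBeta hlow hhigh _ y⟩,
    Finset.eq_univ_of_forall fun i => Equiv.Perm.mem_support.2 (hne i), fun i => ?_, fun i => ?_,
    .inr hsq_low, .inr hsq_high⟩
  · have := hlow i
    have := hlt i
    omega
  · have := hsq_low i
    have := hsq_high i
    have := stefanBetaFun_lt n i
    omega

/-- The permutation `ϕ_{4n+2} := e_{2n+1} |⋄ β_{2n+1}` belongs to `Sim(4n+2)`; in particular it is a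
`(4n+2)`-cycle. -/
theorem varphi_isSim (n : ℕ) (hn : 1 ≤ n) (β : Equiv.Perm (Fin (2 * n + 1)))
    (h : ∀ i : Fin (2 * n + 1), (β i : ℕ) = stefanBetaFun n i) :
    IsSim n ((finCongr (show (2 * n + 1) + (2 * n + 1) = 4 * n + 2 by ring)).permCongr
      (lpaste (1 : Equiv.Perm (Fin (2 * n + 1))) β)) := by
  refine isSim_of_shift_of_stefanBeta (fun i hi => ?_) (fun i hi => ?_)
  · exact lpaste_castAdd 1 β ⟨i, hi⟩
  · rw [← h ⟨i - (2 * n + 1), by omega⟩, ← lpaste_natAdd (1 : Equiv.Perm (Fin (2 * n + 1))) β]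
    simp only [Equiv.permCongr_apply, finCongr_apply, Fin.val_cast]
    congr 2
    ext
    simp
    omega
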